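/- arXiv:math/0701718 — 2 statements merged into one kernel-verified Lean document; each statement's English description precedes it below -/
import Mathlib

section
/- Suppose V(t) = Φ(2t) − Φ(t) → ∞ as t → ∞. Then for every constant c > 0: (i) (Φ(t + c t^{1/2}) − Φ(t)) / V(t)^{1/2} → 0 as t → ∞, and (ii) V(t + c t^{1/2}) / V(t) → 1 as t → ∞. -/
open Filter Topology

/-- Poissonized expected number of occupied boxes. -/
noncomputable def Phi (p : ℕ → ℝ) (t : ℝ) : ℝ := ∑' j, (1 - Real.exp (-t * p j))

/-- Poissonized variance `V(t) = Φ(2t) − Φ(t)`. -/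
noncomputable def Vpois (p : ℕ → ℝ) (t : ℝ) : ℝ := Phi p (2 * t) - Phi p t

noncomputable def DPhi (p : ℕ → ℝ) (t : ℝ) : ℝ := ∑' j, p j * Real.exp (-t * p j)

lemma aux_sum_D (p : ℕ → ℝ) (hpos : ∀ j, 0 < p j) (hs : Summable p) (t : ℝ) (ht : 0 ≤ t) :
    Summable (fun j => p j * Real.exp (-t * p j)) := by
  refine Summable.of_nonneg_of_le (fun j => by have := hpos j; positivity) (fun j => ?_) hs
  have h1 : Real.exp (-t * p j) ≤ 1 := Real.exp_le_one_iff.2 (by nlinarith [hpos j])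
  nlinarith [hpos j]

lemma aux_sum_Phi (p : ℕ → ℝ) (hpos : ∀ j, 0 < p j) (hs : Summable p) (t : ℝ) (ht : 0 ≤ t) :
    Summable (fun j => 1 - Real.exp (-t * p j)) := by
  refine Summable.of_nonneg_of_le (fun j => ?_) (fun j => ?_) (hs.mul_left t)
  · have h1 : Real.exp (-t * p j) ≤ 1 := Real.exp_le_one_iff.2 (by nlinarith [hpos j])
    linarith
  · have := Real.add_one_le_exp (-t * p j)
    linarith

lemma aux_lower (p : ℕ → ℝ) (hpos : ∀ j, 0 < p j) (hs : Summable p) (t h : ℝ) (ht : 0 ≤ t)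
    (hh : 0 ≤ h) : 0 ≤ Phi p (t + h) - Phi p t := by
  unfold Phi
  rw [sub_nonneg]
  refine Summable.tsum_le_tsum (fun j => ?_) (aux_sum_Phi p hpos hs t ht)
    (aux_sum_Phi p hpos hs _ (by positivity))
  have : Real.exp (-(t+h) * p j) ≤ Real.exp (-t * p j) :=
    Real.exp_le_exp.2 (by nlinarith [hpos j, mul_nonneg hh (hpos j).le])
  linarith

lemma aux_upper (p : ℕ → ℝ) (hpos : ∀ j, 0 < p j) (hs : Summable p) (t h : ℝ) (ht : 0 ≤ t)
    (hh : 0 ≤ h) : Phi p (t + h) - Phi p t ≤ h * DPhi p t := by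
  unfold Phi DPhi
  rw [← Summable.tsum_sub (aux_sum_Phi p hpos hs _ (by positivity)) (aux_sum_Phi p hpos hs t ht),
    ← tsum_mul_left]
  refine Summable.tsum_le_tsum (fun j => ?_) ((aux_sum_Phi p hpos hs _ (by positivity)).sub
    (aux_sum_Phi p hpos hs t ht)) ((aux_sum_D p hpos hs t ht).mul_left h)
  have e : Real.exp (-(t+h) * p j) = Real.exp (-t * p j) * Real.exp (-h * p j) := by
    rw [← Real.exp_add]; ring_nf
  rw [e]
  have := Real.add_one_le_exp (-h * p j)
  nlinarith [Real.exp_pos (-t * p j)]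

lemma aux_sinh (x : ℝ) (hx : 0 ≤ x) :
    x * Real.exp (-(3/2) * x) ≤ Real.exp (-x) - Real.exp (-2 * x) := by
  have h := Real.self_le_sinh_iff.2 (show 0 ≤ x / 2 by positivity)
  rw [Real.sinh_eq] at h
  have e1 : Real.exp (-x) = Real.exp (-(3/2)*x) * Real.exp (x/2) := by
    rw [← Real.exp_add]; ring_nf
  have e2 : Real.exp (-2*x) = Real.exp (-(3/2)*x) * Real.exp (-(x/2)) := by
    rw [← Real.exp_add]; ring_nf
  rw [e1, e2]
  nlinarith [Real.exp_pos (-(3/2)*x)]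

lemma aux_V (p : ℕ → ℝ) (hpos : ∀ j, 0 < p j) (hs : Summable p) (t : ℝ) (ht : 0 ≤ t) :
    t * DPhi p (3/2*t) ≤ Vpois p t := by
  unfold Vpois Phi DPhi
  rw [← Summable.tsum_sub (aux_sum_Phi p hpos hs _ (by positivity)) (aux_sum_Phi p hpos hs t ht),
    ← tsum_mul_left]
  refine Summable.tsum_le_tsum (fun j => ?_) ((aux_sum_D p hpos hs _ (by positivity)).mul_left t)
    ((aux_sum_Phi p hpos hs _ (by positivity)).sub (aux_sum_Phi p hpos hs t ht))
  have := aux_sinh (t * p j) (mul_nonneg ht (hpos j).le)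
  ring_nf at this ⊢
  linarith

lemma aux_D_pos (p : ℕ → ℝ) (hpos : ∀ j, 0 < p j) (hs : Summable p) (t : ℝ) (ht : 0 ≤ t) :
    0 < DPhi p t :=
  (aux_sum_D p hpos hs t ht).tsum_pos (fun j => by have := hpos j; positivity) 0
    (by have := hpos 0; positivity)

lemma aux_CS (p : ℕ → ℝ) (hpos : ∀ j, 0 < p j) (hs : Summable p) (t : ℝ) (ht : 0 ≤ t) :
    DPhi p t ^ 2 ≤ DPhi p (t/2) * DPhi p (3/2*t) := by
  have key : ∀ s : ℝ, 0 ≤ DPhi p (t/2) - 2 * s * DPhi p t + s^2 * DPhi p (3/2*t) := by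
    intro s
    have s1 := aux_sum_D p hpos hs (t/2) (by positivity)
    have s2 := (aux_sum_D p hpos hs t ht).mul_left (2*s)
    have s3 := (aux_sum_D p hpos hs (3/2*t) (by positivity)).mul_left (s^2)
    unfold DPhi
    rw [← tsum_mul_left, ← tsum_mul_left, ← s1.tsum_sub s2, ← (s1.sub s2).tsum_add s3]
    refine tsum_nonneg (fun j => ?_)
    have e1 : Real.exp (-t * p j) = Real.exp (-(t/2) * p j) ^ 2 := by
      rw [← Real.exp_nat_mul]; push_cast; ring_nf
    have e2 : Real.exp (-(3/2*t) * p j) = Real.exp (-(t/2) * p j) ^ 3 := by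
      rw [← Real.exp_nat_mul]; push_cast; ring_nf
    rw [e1, e2]
    have hp := hpos j
    have : 0 ≤ p j * Real.exp (-(t/2) * p j) * (1 - s * Real.exp (-(t/2) * p j))^2 := by
      positivity
    linarith
  have hd := aux_D_pos p hpos hs (3/2*t) (by positivity)
  have := discrim_le_zero (a := DPhi p (3/2*t)) (b := -2 * DPhi p t) (c := DPhi p (t/2))
    (fun x => by have := key x; linarith)
  unfold discrim at this
  linarith

lemma aux_D_tendsto (p : ℕ → ℝ) (hpos : ∀ j, 0 < p j) (hs : Summable p) :
    Tendsto (DPhi p) atTop (𝓝 0) := by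
  have := tendsto_tsum_of_dominated_convergence (𝓕 := atTop)
    (f := fun (t : ℝ) j => p j * Real.exp (-t * p j)) (g := fun _ => (0:ℝ)) hs
    (fun j => ?_) ?_
  · rw [tsum_zero] at this
    exact this
  · have h1 : Tendsto (fun t : ℝ => t * p j) atTop atTop :=
      tendsto_id.atTop_mul_const (hpos j)
    have h2 := (Real.tendsto_exp_neg_atTop_nhds_zero.comp h1).const_mul (p j)
    simpa [Function.comp_def] using h2
  · filter_upwards [eventually_ge_atTop 0] with t ht j
    have hp := hpos j
    rw [Real.norm_of_nonneg (by positivity)]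
    have h1 : Real.exp (-t * p j) ≤ 1 := Real.exp_le_one_iff.2 (by nlinarith)
    nlinarith

lemma aux_D_anti (p : ℕ → ℝ) (hpos : ∀ j, 0 < p j) (hs : Summable p) (t : ℝ) (ht : 0 ≤ t) :
    DPhi p (2*t) ≤ DPhi p t := by
  refine Summable.tsum_le_tsum (fun j => ?_) (aux_sum_D p hpos hs _ (by positivity))
    (aux_sum_D p hpos hs t ht)
  have hp := hpos j
  have : Real.exp (-(2*t) * p j) ≤ Real.exp (-t * p j) :=
    Real.exp_le_exp.2 (by nlinarith [mul_nonneg ht hp.le])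
  exact mul_le_mul_of_nonneg_left this hp.le

lemma aux_main (p : ℕ → ℝ) (hpos : ∀ j, 0 < p j) (hs : Summable p) (t : ℝ) (ht : 0 ≤ t) :
    Real.sqrt t * DPhi p t ≤ Real.sqrt (DPhi p (t/2)) * Real.sqrt (Vpois p t) := by
  have h0 := aux_D_pos p hpos hs t ht
  have h1 := aux_D_pos p hpos hs (t/2) (by positivity)
  rw [← Real.sqrt_mul h1.le]
  apply Real.le_sqrt_of_sq_le
  rw [mul_pow, Real.sq_sqrt ht]
  have h2 := aux_CS p hpos hs t ht
  have h3 := aux_V p hpos hs t ht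
  calc t * DPhi p t ^ 2 ≤ t * (DPhi p (t/2) * DPhi p (3/2*t)) := by gcongr
    _ = DPhi p (t/2) * (t * DPhi p (3/2*t)) := by ring
    _ ≤ _ := by gcongr

/-- If `V(t) → ∞` then for every `c > 0`:
`(Φ(t + c√t) − Φ(t))/V(t)^{1/2} → 0` and `V(t + c√t)/V(t) → 1`. -/
theorem stmt_9 (p : ℕ → ℝ) (hpos : ∀ j, 0 < p j) (hmono : Antitone p)
    (hsum : ∑' j, p j = 1)
    (hV : Tendsto (Vpois p) atTop atTop) :
    ∀ c : ℝ, 0 < c →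
      Tendsto
        (fun t : ℝ =>
          (Phi p (t + c * Real.sqrt t) - Phi p t) / Real.sqrt (Vpois p t))
        atTop (𝓝 0) ∧
      Tendsto (fun t : ℝ => Vpois p (t + c * Real.sqrt t) / Vpois p t)
        atTop (𝓝 1) := by
  intro c hc
  have hs : Summable p := by
    by_contra h
    rw [tsum_eq_zero_of_not_summable h] at hsum
    exact zero_ne_one hsum
  have hD : Tendsto (fun t : ℝ => Real.sqrt (DPhi p (t/2))) atTop (𝓝 0) := by
    have h1 := (aux_D_tendsto p hpos hs).comp
      (tendsto_id.atTop_div_const (show (0:ℝ) < 2 by norm_num))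
    have h2 := (Real.continuous_sqrt.tendsto 0).comp h1
    simpa [Function.comp_def] using h2
  constructor
  · have hb : Tendsto (fun t : ℝ => c * Real.sqrt (DPhi p (t/2))) atTop (𝓝 0) := by
      simpa using hD.const_mul c
    refine tendsto_of_tendsto_of_tendsto_of_le_of_le' tendsto_const_nhds hb ?_ ?_
    · filter_upwards [eventually_ge_atTop 0] with t ht
      exact div_nonneg (aux_lower p hpos hs t _ ht (by positivity)) (Real.sqrt_nonneg _)
    · filter_upwards [eventually_ge_atTop 0, hV.eventually_gt_atTop 0] with t ht hv
      rw [div_le_iff₀ (Real.sqrt_pos.2 hv)]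
      have h1 := aux_upper p hpos hs t (c * Real.sqrt t) ht (by positivity)
      have h2 := mul_le_mul_of_nonneg_left (aux_main p hpos hs t ht) hc.le
      linarith
  · have hb : Tendsto (fun t : ℝ => 2 * c * Real.sqrt (DPhi p (t/2))) atTop (𝓝 0) := by
      simpa using hD.const_mul (2 * c)
    rw [tendsto_iff_norm_sub_tendsto_zero]
    refine tendsto_of_tendsto_of_tendsto_of_le_of_le' tendsto_const_nhds hb
      (Eventually.of_forall fun t => norm_nonneg _) ?_
    filter_upwards [eventually_ge_atTop 0, hV.eventually_ge_atTop 1] with t ht hv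
    have hv0 : 0 < Vpois p t := by linarith
    have hq : Real.sqrt (Vpois p t) ≤ Vpois p t := by
      rw [Real.sqrt_le_left hv0.le]; nlinarith
    rw [div_sub_one hv0.ne', Real.norm_eq_abs, abs_div, abs_of_pos hv0, div_le_iff₀ hv0]
    have l1 := aux_lower p hpos hs t (c * Real.sqrt t) ht (by positivity)
    have u1 := aux_upper p hpos hs t (c * Real.sqrt t) ht (by positivity)
    have l2 := aux_lower p hpos hs (2*t) (2*(c * Real.sqrt t)) (by positivity) (by positivity)
    have u2 := aux_upper p hpos hs (2*t) (2*(c * Real.sqrt t)) (by positivity) (by positivity)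
    have an := mul_le_mul_of_nonneg_left (aux_D_anti p hpos hs t ht)
      (show 0 ≤ 2*(c * Real.sqrt t) by positivity)
    have m := mul_le_mul_of_nonneg_left (aux_main p hpos hs t ht) (show 0 ≤ 2 * c by positivity)
    have m2 := mul_le_mul_of_nonneg_left hq
      (show 0 ≤ 2 * c * Real.sqrt (DPhi p (t/2)) by positivity)
    have h0 : 0 ≤ c * Real.sqrt t * DPhi p t :=
      mul_nonneg (by positivity) (aux_D_pos p hpos hs t ht).le
    have e : Vpois p (t + c * Real.sqrt t) - Vpois p t =
        (Phi p (2*t + 2*(c * Real.sqrt t)) - Phi p (2*t)) - (Phi p (t + c * Real.sqrt t) - Phi p t) := by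
      unfold Vpois
      rw [mul_add]; ring
    rw [e, abs_le]
    constructor <;> linarith
end

section
/- Let ℓ_0 be slowly varying at ∞ and suppose ν_1[0,x] ~ x ℓ_0(1/x) as x → 0+. Define ℓ(y) = ∫_1^y u^{−1} ℓ_0(u) du for y > 1. Then ℓ is slowly varying at ∞ with ℓ_0(y)/ℓ(y) → 0, and: (i) ν̄(x) ~ ℓ(1/x) as x → 0+; (ii) for every integer r > 1, ν_r[0,x] ~ (1/r) x^r ℓ_0(1/x) as x → 0+. Conversely, if ν̄(x) ~ ℓ(1/x) as x → 0+ for some slowly varying ℓ, then ν_1[0,x] / (x ℓ(1/x)) → 0 as x → 0+. -/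
open Filter Topology MeasureTheory

/-- Tail counting function `ν̄(x) = #{j : p_j ≥ x}`, as a real number. -/
noncomputable def nubar (p : ℕ → ℝ) (x : ℝ) : ℝ := ({j | x ≤ p j}.ncard : ℝ)

/-- `ν_r[0,x] = ∑_j p_j^r · 1(p_j ≤ x)`. -/
noncomputable def nuR (p : ℕ → ℝ) (r : ℕ) (x : ℝ) : ℝ :=
  ∑' j, if p j ≤ x then p j ^ r else 0

/-- A function `ℓ : (0,∞) → (0,∞)` is slowly varying at `∞` if
`ℓ(cy)/ℓ(y) → 1` as `y → ∞` for every `c > 0`. -/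
def SlowlyVarying (ℓ : ℝ → ℝ) : Prop :=
  ∀ c : ℝ, 0 < c → Tendsto (fun y : ℝ => ℓ (c * y) / ℓ y) atTop (𝓝 1)

/-- `ℓ(y) = ∫_1^y u^{-1} ℓ_0(u) du`. -/
noncomputable def ellInt (ℓ₀ : ℝ → ℝ) (y : ℝ) : ℝ := ∫ u in Set.Ioc 1 y, ℓ₀ u / u


/-! Basic facts -/
lemma aux_summable (p : ℕ → ℝ) (hsum : ∑' j, p j = 1) : Summable p := by
  by_contra h
  rw [tsum_eq_zero_of_not_summable h] at hsum
  norm_num at hsum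

lemma aux_fin (p : ℕ → ℝ) (hs : Summable p) (x : ℝ) (hx : 0 < x) : {j | x ≤ p j}.Finite := by
  have h := hs.tendsto_cofinite_zero
  have h2 := h.eventually (gt_mem_nhds hx)
  rw [Filter.eventually_cofinite] at h2
  simpa using h2

lemma aux_fin' (p : ℕ → ℝ) (hs : Summable p) (x : ℝ) (hx : 0 < x) : {j | x < p j}.Finite :=
  (aux_fin p hs x hx).subset (fun j (hj : x < p j) => (le_of_lt hj : x ≤ p j))

lemma aux_summ_ite (p : ℕ → ℝ) (hpos : ∀ j, 0 < p j) (hs : Summable p) (x : ℝ) :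
    Summable (fun j => if p j ≤ x then p j else 0) := by
  refine Summable.of_nonneg_of_le (fun j => ?_) (fun j => ?_) hs
  · split_ifs
    · exact (hpos j).le
    · exact le_rfl
  · split_ifs
    · exact le_rfl
    · exact (hpos j).le

lemma nuR_one (p : ℕ → ℝ) (x : ℝ) : nuR p 1 x = ∑' j, if p j ≤ x then p j else 0 := by
  simp [nuR]

lemma nuR_mono (p : ℕ → ℝ) (hpos : ∀ j, 0 < p j) (hs : Summable p) : Monotone (nuR p 1) := by
  intro a b hab
  rw [nuR_one, nuR_one]
  refine (aux_summ_ite p hpos hs a).tsum_le_tsum (fun j => ?_) (aux_summ_ite p hpos hs b)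
  have := hpos j
  split_ifs <;> linarith

lemma nuR_pos (p : ℕ → ℝ) (hpos : ∀ j, 0 < p j) (hs : Summable p) (x : ℝ) (hx : 0 < x) :
    0 < nuR p 1 x := by
  rw [nuR_one]
  obtain ⟨j, hj⟩ : ∃ j, p j < x := (hs.tendsto_atTop_zero.eventually (gt_mem_nhds hx)).exists
  refine (aux_summ_ite p hpos hs x).tsum_pos (fun j => ?_) j ?_
  · have := hpos j
    split_ifs <;> linarith
  · rw [if_pos hj.le]; exact hpos j

lemma nuR_tendsto_zero (p : ℕ → ℝ) (hpos : ∀ j, 0 < p j) (hs : Summable p) (x : ℝ) :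
    Tendsto (fun n : ℕ => nuR p 1 (x / 2 ^ n)) atTop (𝓝 0) := by
  simp only [nuR_one]
  have : (0:ℝ) = ∑' j : ℕ, (0:ℝ) := by simp
  nth_rewrite 2 [this]
  refine tendsto_tsum_of_dominated_convergence hs (fun j => ?_) (Eventually.of_forall fun n j => ?_)
  · have h : Tendsto (fun n : ℕ => x / 2 ^ n) atTop (𝓝 0) := by
      have := (tendsto_pow_atTop_nhds_zero_of_lt_one (r := (1/2:ℝ)) (by norm_num) (by norm_num)).const_mul x
      simpa [div_eq_mul_inv] using this
    refine tendsto_const_nhds.congr' ?_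
    filter_upwards [h.eventually (gt_mem_nhds (hpos j))] with n hn
    rw [if_neg (not_le.2 hn)]
  · have := hpos j
    rw [Real.norm_eq_abs]
    split_ifs
    · rw [abs_of_pos this]
    · simpa using this.le

/-- complement formula -/
lemma nuR_compl (p : ℕ → ℝ) (hpos : ∀ j, 0 < p j) (hs : Summable p) (hsum : ∑' j, p j = 1)
    (x z : ℝ) (hz : 0 < z) (hzx : z ≤ x) :
    nuR p 1 x = 1 - ∑ j ∈ (aux_fin' p hs z hz).toFinset, if x < p j then p j else 0 := by
  rw [nuR_one]
  have h1 : ∑ j ∈ (aux_fin' p hs z hz).toFinset, (if x < p j then p j else 0)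
      = ∑' j, if x < p j then p j else 0 := by
    symm
    apply tsum_eq_sum
    intro j hj
    simp at hj
    rw [if_neg (by linarith)]
  have h2 : Summable (fun j => if x < p j then p j else 0) := by
    refine Summable.of_nonneg_of_le (fun j => ?_) (fun j => ?_) hs <;>
    · have := hpos j
      split_ifs <;> linarith
  rw [h1, ← hsum, eq_sub_iff_add_eq, ← (aux_summ_ite p hpos hs x).tsum_add h2]
  congr 1; ext j
  by_cases h : p j ≤ x
  · simp [h, not_lt.2 h]
  · simp [h, not_le.1 h]

lemma block_le (p : ℕ → ℝ) (hpos : ∀ j, 0 < p j) (hs : Summable p) (hsum : ∑' j, p j = 1)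
    (x : ℝ) (hx : 0 < x) :
    nuR p 1 x ≤ nuR p 1 (x / 2) + x * (nubar p (x / 2) - nubar p (2 * x)) := by
  have hx2 : 0 < x / 2 := by linarith
  rw [nuR_compl p hpos hs hsum x (x/2) hx2 (by linarith),
    nuR_compl p hpos hs hsum (x/2) (x/2) hx2 le_rfl]
  set S := (aux_fin' p hs (x/2) hx2).toFinset with hS
  have hA : nubar p (x/2) = ((aux_fin p hs (x/2) hx2).toFinset.card : ℝ) := by
    rw [nubar, Set.ncard_eq_toFinset_card _ (aux_fin p hs (x/2) hx2)]
  have hB : nubar p (2*x) = ((aux_fin p hs (2*x) (by linarith)).toFinset.card : ℝ) := by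
    rw [nubar, Set.ncard_eq_toFinset_card _ (aux_fin p hs (2*x) (by linarith))]
  have h1 : (S.card : ℝ) ≤ nubar p (x/2) := by
    rw [hA]; norm_cast
    apply Finset.card_le_card
    intro j; simp [hS]; intro h; exact h.le
  have h2 : nubar p (2*x) ≤ ((S.filter (fun j => x < p j)).card : ℝ) := by
    rw [hB]; norm_cast
    apply Finset.card_le_card
    intro j; simp [hS]; intro h; constructor <;> linarith
  have h3 : ∑ j ∈ S, ((if x/2 < p j then p j else 0) - (if x < p j then p j else 0))
      ≤ ∑ j ∈ S, (x - x * (if x < p j then 1 else 0)) := by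
    apply Finset.sum_le_sum
    intro j hj
    have := hpos j
    split_ifs <;> linarith
  rw [Finset.sum_sub_distrib, Finset.sum_sub_distrib, ← Finset.mul_sum, Finset.sum_boole] at h3
  simp only [Finset.sum_const, nsmul_eq_mul] at h3
  nlinarith

lemma nubar_anti (p : ℕ → ℝ) (hs : Summable p) (a b : ℝ) (ha : 0 < a) (hab : a ≤ b) :
    nubar p b ≤ nubar p a := by
  unfold nubar
  norm_cast
  exact Set.ncard_le_ncard (fun j hj => le_trans hab hj) (aux_fin p hs a ha)

/-- converse -/
lemma converse_part (p : ℕ → ℝ) (hpos : ∀ j, 0 < p j) (hs : Summable p) (hsum : ∑' j, p j = 1)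
    (ℓ : ℝ → ℝ) (hℓ : ∀ y : ℝ, 0 < y → 0 < ℓ y) (hsv : SlowlyVarying ℓ)
    (h : Tendsto (fun x : ℝ => nubar p x / ℓ (1 / x)) (𝓝[>] 0) (𝓝 1)) :
    Tendsto (fun x : ℝ => nuR p 1 x / (x * ℓ (1 / x))) (𝓝[>] 0) (𝓝 0) := by
  have hinv : Tendsto (fun x : ℝ => 1 / x) (𝓝[>] 0) atTop := by
    simpa using tendsto_inv_nhdsGT_zero (𝕜 := ℝ)
  have hpos' : ∀ᶠ x : ℝ in 𝓝[>] 0, 0 < x := eventually_mem_nhdsWithin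
  have hnpos : ∀ᶠ x : ℝ in 𝓝[>] 0, 0 < nubar p x := by
    filter_upwards [h.eventually (lt_mem_nhds zero_lt_one), hpos'] with x hx hx0
    by_contra hc
    have : nubar p x = 0 := le_antisymm (not_lt.1 hc) (by unfold nubar; positivity)
    simp [this] at hx
  have hmul : ∀ c : ℝ, 0 < c → Tendsto (fun x : ℝ => c * x) (𝓝[>] 0) (𝓝[>] 0) := by
    intro c hc
    refine tendsto_nhdsWithin_iff.2 ⟨?_, ?_⟩
    · have : Tendsto (fun x : ℝ => c * x) (𝓝 0) (𝓝 (c * 0)) := (continuous_const_mul c).tendsto 0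
      rw [mul_zero] at this
      exact this.mono_left nhdsWithin_le_nhds
    · filter_upwards [hpos'] with x hx
      exact mul_pos hc hx
  have hratio : ∀ c : ℝ, 0 < c → Tendsto (fun x => nubar p (c * x) / nubar p x) (𝓝[>] 0) (𝓝 1) := by
    intro c hc
    have h1 := h.comp (hmul c hc)
    have h2 := (hsv c⁻¹ (inv_pos.2 hc)).comp hinv
    have h3 := (h1.mul h2).mul (h.inv₀ one_ne_zero)
    simp only [mul_one, inv_one] at h3
    refine h3.congr' ?_
    filter_upwards [hpos', hnpos] with x hx hn
    have e : c⁻¹ * (1 / x) = 1 / (c * x) := by field_simp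
    simp only [Function.comp, e]
    have a1 := hℓ (1/x) (by positivity)
    have a2 := hℓ (1/(c*x)) (by positivity)
    field_simp
  -- main bound
  have key : ∀ δ : ℝ, 0 < δ → ∀ᶠ x : ℝ in 𝓝[>] 0, nuR p 1 x ≤ 4 * δ * x * nubar p x := by
    intro δ hδ
    have e1 := (hratio (1/2) (by norm_num)).eventually (gt_mem_nhds (show (1:ℝ) < 1 + min (δ/2) (1/2) by
      have : 0 < min (δ/2) (1/2:ℝ) := by positivity
      linarith))
    have e2 := (hratio 2 (by norm_num)).eventually (lt_mem_nhds (show (1:ℝ) - δ/2 < 1 by linarith))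
    have e3 := (e1.and e2).and hnpos
    rw [eventually_nhdsWithin_iff, Metric.eventually_nhds_iff] at e3
    obtain ⟨x0, hx0, H⟩ := e3
    have H' : ∀ x, 0 < x → x < x0 → nubar p (x/2) - nubar p (2*x) ≤ δ * nubar p x ∧
        nubar p (x/2) ≤ 3/2 * nubar p x := by
      intro x hx hxx
      obtain ⟨⟨a, b⟩, c⟩ := H (show dist x 0 < x0 by simpa [abs_of_pos hx] using hxx) hx
      rw [div_lt_iff₀ c] at a
      rw [lt_div_iff₀ c] at b
      have e : 1/2 * x = x/2 := by ring
      rw [e] at a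
      have m1 := min_le_left (δ/2) (1/2)
      have m2 := min_le_right (δ/2) (1/2)
      constructor <;> nlinarith
    have ind : ∀ n : ℕ, ∀ x, 0 < x → x < x0 → nuR p 1 x ≤ 4 * δ * x * nubar p x + nuR p 1 (x / 2^n) := by
      intro n
      induction n with
      | zero =>
        intro x hx hxx
        have : 0 ≤ nubar p x := by unfold nubar; positivity
        have : 0 ≤ 4 * δ * x * nubar p x := by positivity
        simp; linarith
      | succ n ih =>
        intro x hx hxx
        have i1 := ih (x/2) (by linarith) (by linarith)
        have i2 := block_le p hpos hs hsum x hx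
        obtain ⟨a, b⟩ := H' x hx hxx
        have e : x / 2 / 2 ^ n = x / 2 ^ (n+1) := by rw [pow_succ]; field_simp
        rw [e] at i1
        have a' := mul_le_mul_of_nonneg_left a hx.le
        have b' := mul_le_mul_of_nonneg_left b (show 0 ≤ 2 * δ * x by positivity)
        nlinarith
    filter_upwards [hpos', (eventually_lt_nhds hx0).filter_mono nhdsWithin_le_nhds] with x hx hxx
    have t := (nuR_tendsto_zero p hpos hs x).const_add (4 * δ * x * nubar p x)
    rw [add_zero] at t
    exact ge_of_tendsto t (Eventually.of_forall fun n => ind n x hx hxx)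
  rw [Metric.tendsto_nhds]
  intro ε hε
  filter_upwards [key (ε/16) (by positivity), hpos', h.eventually (gt_mem_nhds (show (1:ℝ) < 2 by norm_num))]
    with x h1 hx h2
  have a1 := hℓ (1/x) (by positivity)
  rw [div_lt_iff₀ a1] at h2
  have hF := nuR_pos p hpos hs x hx
  rw [Real.dist_eq, sub_zero, abs_of_pos (by positivity), div_lt_iff₀ (by positivity)]
  have := mul_lt_mul_of_pos_left h2 (show 0 < 4 * (ε/16) * x by positivity)
  nlinarith [mul_pos (mul_pos hε hx) a1]

/-! Generic lemmas about an antitone integrand -/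
lemma anti_ii {f : ℝ → ℝ} (hf : AntitoneOn f (Set.Ioi 0)) (a b : ℝ) (ha : 0 < a) (hb : 0 < b) :
    IntervalIntegrable f volume a b := by
  apply AntitoneOn.intervalIntegrable
  apply hf.mono
  intro x hx
  exact lt_of_lt_of_le (lt_min ha hb) hx.1

lemma anti_upper {f : ℝ → ℝ} (hf : AntitoneOn f (Set.Ioi 0)) (a b : ℝ) (ha : 0 < a) (hab : a ≤ b) :
    ∫ u in a..b, f u ≤ (b - a) * f a := by
  have h := intervalIntegral.integral_mono_on (μ := volume) hab
    (anti_ii hf a b ha (ha.trans_le hab)) (intervalIntegrable_const (c := f a))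
    (fun x hx => hf ha (ha.trans_le hx.1) hx.1)
  simpa using h

lemma anti_lower {f : ℝ → ℝ} (hf : AntitoneOn f (Set.Ioi 0)) (a b : ℝ) (ha : 0 < a) (hab : a ≤ b) :
    (b - a) * f b ≤ ∫ u in a..b, f u := by
  have h := intervalIntegral.integral_mono_on (μ := volume) hab (intervalIntegrable_const (c := f b))
    (anti_ii hf a b ha (ha.trans_le hab))
    (fun x hx => hf (ha.trans_le hx.1) (ha.trans_le hab) hx.2)
  simpa using h

lemma I_nonneg {f : ℝ → ℝ} (hp : ∀ u, 0 < u → 0 < f u) (a y : ℝ) (ha : 0 < a) (hy : a ≤ y) :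
    0 ≤ ∫ u in a..y, f u :=
  intervalIntegral.integral_nonneg hy (fun u hu => (hp u (ha.trans_le hu.1)).le)

/-- `y f(y) = o(I(y))` -/
lemma G_over_I {f : ℝ → ℝ} (hf : AntitoneOn f (Set.Ioi 0)) (hp : ∀ u, 0 < u → 0 < f u)
    (hr : Tendsto (fun y => f (2 * y) / f y) atTop (𝓝 (1/2))) :
    Tendsto (fun y => y * f y / ∫ u in (1:ℝ)..y, f u) atTop (𝓝 0) := by
  have key : ∀ n : ℕ, ∀ᶠ y in atTop, (n:ℝ)/4 * (y * f y) ≤ ∫ u in (1:ℝ)..y, f u := by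
    intro n
    induction n with
    | zero =>
      filter_upwards [eventually_ge_atTop 1] with y hy
      simpa using I_nonneg hp 1 y one_pos hy
    | succ n ih =>
      have e1 := hr.eventually (gt_mem_nhds (show (1:ℝ)/2 < 1/2 * (1 + 1/(n+1)) by
        have : (0:ℝ) < 1/((n:ℝ)+1) := by positivity
        linarith))
      have : ∀ᶠ y in atTop, ((n+1 : ℕ):ℝ)/4 * ((2*y) * f (2*y)) ≤ ∫ u in (1:ℝ)..(2*y), f u := by
        filter_upwards [ih, e1, eventually_ge_atTop 1] with y h1 h2 hy
        have hy0 : 0 < y := by linarith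
        have l := anti_lower hf y (2*y) hy0 (by linarith)
        have ad := intervalIntegral.integral_add_adjacent_intervals
          (anti_ii hf 1 y one_pos hy0) (anti_ii hf y (2*y) hy0 (by linarith))
        rw [← ad]
        have hfy := hp y hy0
        have hf2 := hp (2*y) (by linarith)
        rw [div_lt_iff₀ hfy] at h2
        -- n f(2y) ≤ n/2 f y + 1/2 f y ... use f 2y bound
        have hn : (0:ℝ) ≤ n := Nat.cast_nonneg n
        have h3 : f (2*y) * (n+1) ≤ 1/2 * (n + 2) * f y := by
          have := mul_le_mul_of_nonneg_right h2.le (show (0:ℝ) ≤ n+1 by positivity)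
          have e : 1 / 2 * (1 + 1 / ((n:ℝ) + 1)) * f y * (n+1) = 1/2 * (n+2) * f y := by
            field_simp; ring
          linarith
        -- hence n*f y ≥ 2 n (n+1)/(n+2) f(2y) ≥ 2 (n-1) f(2y)
        have h4 : 2 * ((n:ℝ) - 1) * f (2*y) ≤ n * f y := by
          have : (n+2) * (2 * ((n:ℝ) - 1) * f (2*y)) ≤ (n+2) * (n * f y) := by nlinarith
          exact le_of_mul_le_mul_left this (by positivity)
        have h5 := mul_le_mul_of_nonneg_left h4 hy0.le
        push_cast
        nlinarith
      have t : Tendsto (fun y : ℝ => y / 2) atTop atTop := tendsto_id.atTop_div_const (by norm_num)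
      filter_upwards [t.eventually this] with y hy
      have e : 2 * (y/2) = y := by ring
      rwa [e] at hy
  rw [Metric.tendsto_nhds]
  intro ε hε
  obtain ⟨n, hn⟩ := exists_nat_gt (4/ε)
  filter_upwards [key n, eventually_gt_atTop 1] with y h1 hy
  have hy0 : 0 < y := by linarith
  have hfy := hp y hy0
  have hn0 : (0:ℝ) < n := lt_trans (by positivity) hn
  have hI : 0 < ∫ u in (1:ℝ)..y, f u := lt_of_lt_of_le (by positivity) h1
  rw [Real.dist_eq, sub_zero, abs_of_pos (by positivity), div_lt_iff₀ hI]
  rw [div_lt_iff₀ hε] at hn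
  have : y * f y < ε * ((n:ℝ)/4 * (y * f y)) := by
    have : 0 < y * f y := by positivity
    nlinarith
  exact this.trans_le (mul_le_mul_of_nonneg_left h1 hε.le)

lemma L_over_I {f h : ℝ → ℝ} (hf : AntitoneOn f (Set.Ioi 0)) (hp : ∀ u, 0 < u → 0 < f u)
    (hh : ∀ y, 1 ≤ y → IntervalIntegrable h volume 1 y)
    (hr : Tendsto (fun y => h y / f y) atTop (𝓝 1))
    (hI : Tendsto (fun y => ∫ u in (1:ℝ)..y, f u) atTop atTop) :
    Tendsto (fun y => (∫ u in (1:ℝ)..y, h u) / ∫ u in (1:ℝ)..y, f u) atTop (𝓝 1) := by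
  rw [Metric.tendsto_nhds]
  intro ε hε
  rw [Metric.tendsto_nhds] at hr
  obtain ⟨M0, hM0⟩ := eventually_atTop.1 (hr (ε/2) (by positivity))
  set M := max M0 1
  have hM1 : 1 ≤ M := le_max_right _ _
  have hMp : 0 < M := by linarith
  have hb : ∀ u, M ≤ u → ‖h u - f u‖ ≤ ε/2 * f u := by
    intro u hu
    have := hM0 u ((le_max_left _ _).trans hu)
    have hfu := hp u (by linarith)
    rw [Real.dist_eq] at this
    have e : h u - f u = (h u / f u - 1) * f u := by field_simp
    rw [e, norm_mul, Real.norm_eq_abs, Real.norm_eq_abs, abs_of_pos hfu]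
    exact mul_le_mul_of_nonneg_right this.le hfu.le
  set C := |∫ u in (1:ℝ)..M, (h u - f u)|
  filter_upwards [hI.eventually_gt_atTop (2 * C / ε), hI.eventually_gt_atTop 0,
    eventually_ge_atTop M] with y h1 hIp hy
  have hy1 : 1 ≤ y := hM1.trans hy
  have if1 := anti_ii hf 1 y one_pos (by linarith)
  have if2 := anti_ii hf M y hMp (by linarith)
  have if3 := anti_ii hf 1 M one_pos hMp
  have ih2 : IntervalIntegrable h volume M y := (hh M hM1).symm.trans (hh y hy1)
  have s : (∫ u in (1:ℝ)..y, h u) - ∫ u in (1:ℝ)..y, f u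
      = (∫ u in (1:ℝ)..M, (h u - f u)) + ∫ u in M..y, (h u - f u) := by
    rw [intervalIntegral.integral_add_adjacent_intervals ((hh M hM1).sub if3) (ih2.sub if2),
      intervalIntegral.integral_sub (hh y hy1) if1]
  have b2 : ‖∫ u in M..y, (h u - f u)‖ ≤ ∫ u in M..y, ε/2 * f u :=
    intervalIntegral.norm_integral_le_of_norm_le hy
      (Eventually.of_forall fun u hu => hb u hu.1.le) (if2.const_mul _)
  rw [intervalIntegral.integral_const_mul] at b2
  have ad := intervalIntegral.integral_add_adjacent_intervals if3 if2
  have n1 := I_nonneg hp 1 M one_pos hM1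
  rw [Real.dist_eq]
  have e : (∫ u in (1:ℝ)..y, h u) / (∫ u in (1:ℝ)..y, f u) - 1
    = ((∫ u in (1:ℝ)..y, h u) - ∫ u in (1:ℝ)..y, f u) / (∫ u in (1:ℝ)..y, f u) := by
    rw [sub_div, div_self hIp.ne']
  rw [e, abs_div, abs_of_pos hIp, div_lt_iff₀ hIp, s]
  rw [div_lt_iff₀ hε] at h1
  rw [Real.norm_eq_abs] at b2
  have := abs_add_le (∫ u in (1:ℝ)..M, (h u - f u)) (∫ u in M..y, (h u - f u))
  nlinarith

lemma I_sv {f : ℝ → ℝ} (hf : AntitoneOn f (Set.Ioi 0)) (hp : ∀ u, 0 < u → 0 < f u)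
    (hI : Tendsto (fun y => ∫ u in (1:ℝ)..y, f u) atTop atTop)
    (hG : Tendsto (fun y => y * f y / ∫ u in (1:ℝ)..y, f u) atTop (𝓝 0)) :
    SlowlyVarying (fun y => ∫ u in (1:ℝ)..y, f u) := by
  have main : ∀ c : ℝ, 1 ≤ c → Tendsto (fun y : ℝ => (∫ u in (1:ℝ)..(c*y), f u) / ∫ u in (1:ℝ)..y, f u)
      atTop (𝓝 1) := by
    intro c hc
    have up := ((hG.const_mul (c-1)).const_add 1)
    rw [mul_zero, add_zero] at up
    refine tendsto_of_tendsto_of_tendsto_of_le_of_le' tendsto_const_nhds up ?_ ?_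
    all_goals
      filter_upwards [hI.eventually_gt_atTop 0, eventually_ge_atTop 1] with y h1 hy
      have hy0 : 0 < y := by linarith
      have hcy : y ≤ c * y := by nlinarith
      have ad := intervalIntegral.integral_add_adjacent_intervals
          (anti_ii hf 1 y one_pos hy0) (anti_ii hf y (c*y) hy0 (by linarith))
      have u := anti_upper hf y (c*y) hy0 hcy
      have n := I_nonneg hp y (c*y) hy0 hcy
    · rw [le_div_iff₀ h1]; linarith
    · rw [div_le_iff₀ h1, add_mul, one_mul, mul_assoc, div_mul_cancel₀ _ h1.ne']; linarith
  intro c hc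
  rcases le_total 1 c with h | h
  · exact main c h
  · have m := (main c⁻¹ ((one_le_inv₀ hc).2 h)).inv₀ one_ne_zero
    have t : Tendsto (fun y : ℝ => c * y) atTop atTop := tendsto_id.const_mul_atTop hc
    have m2 := m.comp t
    rw [inv_one] at m2
    refine m2.congr (fun y => ?_)
    simp only [Function.comp, inv_div, inv_mul_cancel_left₀ hc.ne']

lemma sv_congr {a b : ℝ → ℝ} (ha : SlowlyVarying a) (hpos : ∀ᶠ y in atTop, 0 < a y)
    (h : Tendsto (fun y => b y / a y) atTop (𝓝 1)) : SlowlyVarying b := by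
  intro c hc
  have t : Tendsto (fun y : ℝ => c * y) atTop atTop := tendsto_id.const_mul_atTop hc
  have m := ((h.comp t).mul (ha c hc)).mul (h.inv₀ one_ne_zero)
  simp only [mul_one, inv_one] at m
  refine m.congr' ?_
  filter_upwards [hpos, t.eventually hpos] with y h1 h2
  simp only [Function.comp]
  rw [inv_div]
  have : a y ≠ 0 := h1.ne'
  have : a (c*y) ≠ 0 := h2.ne'
  by_cases hb : b y = 0
  · simp [hb]
  field_simp

lemma ite_int (q y : ℝ) (hq : 0 < q) (hq1 : q ≤ 1) (hy : 1 ≤ y) (hyq : 1 / y < q) :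
    IntervalIntegrable (fun u : ℝ => if 1 / u < q then q else 0) volume 1 y ∧
    ∫ u in (1:ℝ)..y, (if 1 / u < q then q else 0) = q * y - 1 := by
  have hmon : MonotoneOn (fun u : ℝ => if 1 / u < q then q else 0) (Set.Ioi 0) := by
    intro a ha b hb hab
    have ha : 0 < a := ha
    have : 1 / b ≤ 1 / a := one_div_le_one_div_of_le ha hab
    dsimp only
    split_ifs <;> linarith
  have hy0 : 0 < y := by linarith
  have hii : ∀ a b : ℝ, 0 < a → 0 < b →
      IntervalIntegrable (fun u : ℝ => if 1 / u < q then q else 0) volume a b := by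
    intro a b ha hb
    apply MonotoneOn.intervalIntegrable
    apply hmon.mono
    intro x hx
    exact lt_of_lt_of_le (lt_min ha hb) hx.1
  refine ⟨hii 1 y one_pos hy0, ?_⟩
  have hq' : 1 ≤ 1 / q := by rw [le_div_iff₀ hq]; linarith
  have hqy : 1 / q ≤ y := by
    rw [div_lt_iff₀ hy0] at hyq
    rw [div_le_iff₀ hq]; linarith
  rw [← intervalIntegral.integral_add_adjacent_intervals
    (hii 1 (1/q) one_pos (by positivity)) (hii (1/q) y (by positivity) hy0)]
  have i1 : ∫ u in (1:ℝ)..(1/q), (if 1 / u < q then q else 0) = ∫ u in (1:ℝ)..(1/q), (0:ℝ) := by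
    apply intervalIntegral.integral_congr
    intro u hu
    rw [Set.uIcc_of_le hq'] at hu
    have hu0 : 0 < u := by linarith [hu.1]
    have : q ≤ 1 / u := by
      rw [le_div_iff₀ hu0]; have := hu.2; rw [le_div_iff₀ hq] at this; linarith
    exact if_neg (not_lt.2 this)
  have i2 : ∫ u in (1/q)..y, (if 1 / u < q then q else 0) = ∫ u in (1/q)..y, q := by
    apply intervalIntegral.integral_congr_ae
    refine Eventually.of_forall fun u hu => ?_
    rw [Set.uIoc_of_le hqy] at hu
    have h1 := hu.1
    have hu0 : 0 < u := by linarith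
    rw [div_lt_iff₀ hq] at h1
    have : 1 / u < q := by rw [div_lt_iff₀ hu0]; linarith
    exact if_pos this
  rw [i1, i2]
  simp
  field_simp

lemma p_le_one (p : ℕ → ℝ) (hpos : ∀ j, 0 < p j) (hs : Summable p) (hsum : ∑' j, p j = 1) (j : ℕ) :
    p j ≤ 1 := by
  rw [← hsum]; exact hs.le_tsum j (fun i _ => (hpos i).le)

lemma I_ident (p : ℕ → ℝ) (hpos : ∀ j, 0 < p j) (hs : Summable p) (hsum : ∑' j, p j = 1)
    (y : ℝ) (hy : 1 ≤ y) :
    ∫ u in (1:ℝ)..y, nuR p 1 (1/u) = ({j | 1/y < p j}.ncard : ℝ) - 1 + y * nuR p 1 (1/y) := by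
  have hy0 : 0 < y := by linarith
  have hz : 0 < 1/y := by positivity
  rw [Set.ncard_eq_toFinset_card _ (aux_fin' p hs (1/y) hz)]
  set S := (aux_fin' p hs (1/y) hz).toFinset with hS
  have hSm : ∀ j ∈ S, 1/y < p j := by intro j hj; simpa [hS] using hj
  have e1 : ∫ u in (1:ℝ)..y, nuR p 1 (1/u)
      = ∫ u in (1:ℝ)..y, (1 - ∑ j ∈ S, if 1/u < p j then p j else 0) := by
    apply intervalIntegral.integral_congr
    intro u hu
    rw [Set.uIcc_of_le hy] at hu
    exact nuR_compl p hpos hs hsum (1/u) (1/y) hz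
      (one_div_le_one_div_of_le (by linarith [hu.1]) hu.2)
  have hi := fun j hj => ite_int (p j) y (hpos j) (p_le_one p hpos hs hsum j) hy (hSm j hj)
  have hint : IntervalIntegrable (fun u : ℝ => ∑ j ∈ S, if 1/u < p j then p j else 0) volume 1 y := by
    have := IntervalIntegrable.sum (μ := volume) (a := 1) (b := y) S
      (f := fun j u => if 1/u < p j then p j else 0) (fun j hj => (hi j hj).1)
    have e : (fun u : ℝ => ∑ j ∈ S, if 1/u < p j then p j else 0)
        = ∑ j ∈ S, (fun u : ℝ => if 1/u < p j then p j else 0) := by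
      ext u; simp
    rw [e]
    exact this
  rw [e1, intervalIntegral.integral_sub intervalIntegrable_const hint,
    intervalIntegral.integral_finsetSum (fun j hj => (hi j hj).1),
    Finset.sum_congr rfl (fun j hj => (hi j hj).2),
    nuR_compl p hpos hs hsum (1/y) (1/y) hz le_rfl]
  rw [Finset.sum_congr rfl (fun j hj => if_pos (hSm j hj))]
  rw [Finset.sum_sub_distrib, ← Finset.sum_mul]
  simp
  ring

lemma nubar_bounds (p : ℕ → ℝ) (hpos : ∀ j, 0 < p j) (hs : Summable p) (x : ℝ) (hx : 0 < x) :
    ({j | x < p j}.ncard : ℝ) ≤ nubar p x ∧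
    nubar p x ≤ ({j | x < p j}.ncard : ℝ) + nuR p 1 x / x := by
  have hfE : {j | p j = x}.Finite := (aux_fin p hs x hx).subset (fun j (hj : p j = x) => hj.ge)
  constructor
  · unfold nubar
    norm_cast
    exact Set.ncard_le_ncard (fun j (hj : x < p j) => (hj.le : x ≤ p j)) (aux_fin p hs x hx)
  · have h1 : nubar p x ≤ ({j | x < p j}.ncard : ℝ) + ({j | p j = x}.ncard : ℝ) := by
      unfold nubar
      norm_cast
      refine le_trans (Set.ncard_le_ncard ?_ ((aux_fin' p hs x hx).union hfE)) (Set.ncard_union_le _ _)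
      intro j (hj : x ≤ p j)
      rcases hj.lt_or_eq with h | h
      · exact Or.inl h
      · exact Or.inr h.symm
    have h2 : ({j | p j = x}.ncard : ℝ) ≤ nuR p 1 x / x := by
      rw [le_div_iff₀ hx, nuR_one, Set.ncard_eq_toFinset_card _ hfE]
      refine le_trans ?_ ((aux_summ_ite p hpos hs x).sum_le_tsum hfE.toFinset (fun j _ => ?_))
      · rw [Finset.sum_congr rfl (g := fun _ => x)]
        · simp
        · intro j hj
          have : p j = x := by simpa using hj
          simp [this]
      · have := hpos j
        split_ifs <;> linarith
    linarith

lemma I_atTop (p : ℕ → ℝ) (hpos : ∀ j, 0 < p j) (hmono : Antitone p) (hs : Summable p)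
    (hsum : ∑' j, p j = 1) :
    Tendsto (fun y => ∫ u in (1:ℝ)..y, nuR p 1 (1/u)) atTop atTop := by
  rw [tendsto_atTop]
  intro b
  obtain ⟨n, hn⟩ := exists_nat_gt (b + 1)
  filter_upwards [eventually_ge_atTop 1, eventually_gt_atTop (1 / p n)] with y hy hyn
  have hy0 : 0 < y := by linarith
  have hz : 0 < 1/y := by positivity
  rw [I_ident p hpos hs hsum y hy]
  have h1 : (n:ℝ) ≤ ({j | 1/y < p j}.ncard : ℝ) := by
    norm_cast
    have := Set.ncard_le_ncard (s := (Finset.range n : Set ℕ)) (t := {j | 1/y < p j}) ?_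
      (aux_fin' p hs _ hz)
    · simpa [Set.ncard_coe_finset] using this
    · intro j hj
      have hj : j < n := by simpa using hj
      have h2 := hmono hj.le
      have : 1 / y < p n := by
        rw [div_lt_iff₀ (hpos n)] at hyn
        rw [div_lt_iff₀ hy0]; linarith
      exact this.trans_le h2
  have := nuR_pos p hpos hs (1/y) hz
  have : 0 < y * nuR p 1 (1/y) := by positivity
  linarith

/-- Abel summation for `nuR` -/
lemma term_int (m : ℕ) (q x : ℝ) (hq : 0 < q) (hx : 0 < x) :
    ∫ t in (0:ℝ)..1, (t ^ m * if q ≤ t * x then q else 0)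
      = ((if q ≤ x then q else 0) - (if q ≤ x then q ^ (m+2) else 0) / x ^ (m+1)) / (m+1) := by
  by_cases h : q ≤ x
  · have hqx : q / x ≤ 1 := by rw [div_le_one hx]; exact h
    have hqx0 : 0 < q / x := by positivity
    have z1 : ∀ t ∈ Set.uIoo (0:ℝ) (q/x), (t ^ m * if q ≤ t * x then q else 0) = (fun _ => (0:ℝ)) t := by
      intro t ht
      rw [Set.uIoo_of_le hqx0.le] at ht
      have := ht.2
      rw [lt_div_iff₀ hx] at this
      simp [not_le.2 this]
    have z2 : ∀ t ∈ Set.uIcc (q/x) (1:ℝ), (t ^ m * if q ≤ t * x then q else 0) = (fun t => t ^ m * q) t := by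
      intro t ht
      rw [Set.uIcc_of_le hqx] at ht
      have := ht.1
      rw [div_le_iff₀ hx] at this
      simp [this]
    have i1 : IntervalIntegrable (fun t : ℝ => t ^ m * if q ≤ t * x then q else 0) volume 0 (q/x) :=
      (intervalIntegrable_const (c := (0:ℝ))).congr_uIoo (fun t ht => (z1 t ht).symm)
    have i2 : IntervalIntegrable (fun t : ℝ => t ^ m * if q ≤ t * x then q else 0) volume (q/x) 1 :=
      (Continuous.intervalIntegrable (u := fun t : ℝ => t ^ m * q) (by fun_prop) _ _).congr_uIoo
        (fun t ht => (z2 t (Set.uIoo_subset_uIcc_self ht)).symm)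
    rw [← intervalIntegral.integral_add_adjacent_intervals i1 i2,
      intervalIntegral.integral_congr z2, intervalIntegral.integral_congr_uIoo z1]
    simp only [intervalIntegral.integral_zero, intervalIntegral.integral_mul_const, integral_pow,
      if_pos h, div_pow]
    field_simp
    ring
  · have z1 : ∀ t ∈ Set.uIcc (0:ℝ) 1, (t ^ m * if q ≤ t * x then q else 0) = (fun _ => (0:ℝ)) t := by
      intro t ht
      rw [Set.uIcc_of_le zero_le_one] at ht
      have : t * x < q := by nlinarith [ht.1, ht.2, not_le.1 h]
      simp [not_le.2 this]
    rw [intervalIntegral.integral_congr z1]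
    simp [h]

lemma abel (p : ℕ → ℝ) (hpos : ∀ j, 0 < p j) (hs : Summable p)
    (m : ℕ) (x : ℝ) (hx : 0 < x) :
    nuR p (m+2) x = x ^ (m+1) * (nuR p 1 x - (m+1) * ∫ t in (0:ℝ)..1, t ^ m * nuR p 1 (t * x)) := by
  have H : HasSum (fun j => ∫ t in (0:ℝ)..1, (t ^ m * if p j ≤ t * x then p j else 0))
      (∫ t in (0:ℝ)..1, t ^ m * nuR p 1 (t * x)) := by
    refine intervalIntegral.hasSum_integral_of_dominated_convergence (fun j _ => p j) ?_ ?_ ?_ ?_ ?_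
    · intro j
      apply Measurable.aestronglyMeasurable
      refine (measurable_id.pow_const m).mul (Measurable.ite ?_ measurable_const measurable_const)
      exact measurableSet_le measurable_const (measurable_id.mul_const x)
    · intro j
      refine Eventually.of_forall fun t ht => ?_
      rw [Set.uIoc_of_le zero_le_one] at ht
      have h1 : t ^ m ≤ 1 := pow_le_one₀ ht.1.le ht.2
      have h0 : 0 ≤ t ^ m := pow_nonneg ht.1.le m
      have := hpos j
      rw [norm_mul, Real.norm_eq_abs, Real.norm_eq_abs, abs_of_nonneg h0]
      split_ifs
      · rw [abs_of_pos this]; nlinarith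
      · simpa using this.le
    · exact Eventually.of_forall fun t _ => hs
    · exact intervalIntegrable_const
    · refine Eventually.of_forall fun t _ => ?_
      rw [nuR_one]
      exact (aux_summ_ite p hpos hs (t*x)).hasSum.mul_left _
  have h2 := H.mul_left ((m:ℝ)+1)
  have h3 := (aux_summ_ite p hpos hs x).hasSum
  rw [← nuR_one] at h3
  have h4 := (h3.sub h2).mul_left (x ^ (m+1))
  rw [← h4.tsum_eq, nuR]
  congr 1; ext j
  rw [term_int m (p j) x (hpos j) hx]
  have : (m:ℝ) + 1 ≠ 0 := by positivity
  field_simp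
  ring

lemma part_two (p : ℕ → ℝ) (hpos : ∀ j, 0 < p j) (hs : Summable p)
    (hr : ∀ c, 0 < c → Tendsto (fun x => nuR p 1 (c * x) / nuR p 1 x) (𝓝[>] 0) (𝓝 c)) (m : ℕ) :
    Tendsto (fun x => nuR p (m+2) x / (x ^ (m+1) * nuR p 1 x)) (𝓝[>] 0) (𝓝 (1 / ((m:ℝ)+2))) := by
  have D : Tendsto (fun x => ∫ t in (0:ℝ)..1, t ^ m * (nuR p 1 (t * x) / nuR p 1 x)) (𝓝[>] 0)
      (𝓝 (∫ t in (0:ℝ)..1, t ^ m * t)) := by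
    refine intervalIntegral.tendsto_integral_filter_of_dominated_convergence (fun _ => 1) ?_ ?_ ?_ ?_
    · refine Eventually.of_forall fun x => ?_
      apply Measurable.aestronglyMeasurable
      refine (measurable_id.pow_const m).mul (Measurable.div_const ?_ _)
      exact (nuR_mono p hpos hs).measurable.comp (measurable_id.mul_const x)
    · filter_upwards [eventually_mem_nhdsWithin] with x hx
      have hx : 0 < x := hx
      refine Eventually.of_forall fun t ht => ?_
      rw [Set.uIoc_of_le zero_le_one] at ht
      have h1 : t ^ m ≤ 1 := pow_le_one₀ ht.1.le ht.2
      have h0 : 0 ≤ t ^ m := pow_nonneg ht.1.le m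
      have a := nuR_pos p hpos hs x hx
      have b := nuR_pos p hpos hs (t*x) (mul_pos ht.1 hx)
      have c : nuR p 1 (t*x) ≤ nuR p 1 x := nuR_mono p hpos hs (by nlinarith [ht.2])
      rw [Real.norm_eq_abs, abs_of_nonneg (by positivity)]
      exact mul_le_one₀ h1 (by positivity) ((div_le_one a).2 c)
    · exact intervalIntegrable_const
    · refine Eventually.of_forall fun t ht => ?_
      rw [Set.uIoc_of_le zero_le_one] at ht
      exact (hr t ht.1).const_mul _
  have e : ∫ t in (0:ℝ)..1, t ^ m * t = 1 / ((m:ℝ)+2) := by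
    simp only [← pow_succ, integral_pow]
    push_cast
    simp
    ring
  rw [e] at D
  have D2 := (D.const_mul ((m:ℝ)+1)).const_sub 1
  have e2 : 1 - ((m:ℝ)+1) * (1 / ((m:ℝ)+2)) = 1 / ((m:ℝ)+2) := by field_simp; ring
  rw [e2] at D2
  refine D2.congr' ?_
  filter_upwards [eventually_mem_nhdsWithin] with x hx
  have hx : 0 < x := hx
  have a := nuR_pos p hpos hs x hx
  rw [abel p hpos hs m x hx]
  have : ∫ t in (0:ℝ)..1, t ^ m * (nuR p 1 (t * x) / nuR p 1 x)
     = (∫ t in (0:ℝ)..1, t ^ m * nuR p 1 (t * x)) / nuR p 1 x := by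
    rw [← intervalIntegral.integral_div]
    congr 1; ext t; ring
  rw [this]
  generalize (∫ t in (0:ℝ)..1, t ^ m * nuR p 1 (t * x)) = J
  field_simp

lemma forward_part (p : ℕ → ℝ) (hpos : ∀ j, 0 < p j) (hmono : Antitone p) (hs : Summable p)
    (hsum : ∑' j, p j = 1)
    (ℓ₀ : ℝ → ℝ) (hℓ : ∀ y : ℝ, 0 < y → 0 < ℓ₀ y) (hsv : SlowlyVarying ℓ₀)
    (hint : ∀ y : ℝ, 1 < y → IntegrableOn (fun u : ℝ => ℓ₀ u / u) (Set.Ioc 1 y))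
    (h : Tendsto (fun x : ℝ => nuR p 1 x / (x * ℓ₀ (1 / x))) (𝓝[>] 0) (𝓝 1)) :
    SlowlyVarying (ellInt ℓ₀) ∧
      Tendsto (fun y : ℝ => ℓ₀ y / ellInt ℓ₀ y) atTop (𝓝 0) ∧
      Tendsto (fun x : ℝ => nubar p x / ellInt ℓ₀ (1 / x)) (𝓝[>] 0) (𝓝 1) ∧
      (∀ r : ℕ, 1 < r →
        Tendsto
          (fun x : ℝ => nuR p r x / (1 / (r : ℝ) * x ^ (r : ℕ) * ℓ₀ (1 / x)))
          (𝓝[>] 0) (𝓝 1)) := by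
  have hinv : Tendsto (fun x : ℝ => 1 / x) (𝓝[>] 0) atTop := by
    simpa using tendsto_inv_nhdsGT_zero (𝕜 := ℝ)
  have hinv' : Tendsto (fun x : ℝ => 1 / x) atTop (𝓝[>] 0) := by
    simpa using tendsto_inv_atTop_nhdsGT_zero (𝕜 := ℝ)
  have hpos' : ∀ᶠ x : ℝ in 𝓝[>] 0, 0 < x := eventually_mem_nhdsWithin
  have hmul : ∀ c : ℝ, 0 < c → Tendsto (fun x : ℝ => c * x) (𝓝[>] 0) (𝓝[>] 0) := by
    intro c hc
    refine tendsto_nhdsWithin_iff.2 ⟨?_, ?_⟩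
    · have : Tendsto (fun x : ℝ => c * x) (𝓝 0) (𝓝 (c * 0)) := (continuous_const_mul c).tendsto 0
      rw [mul_zero] at this
      exact this.mono_left nhdsWithin_le_nhds
    · filter_upwards [hpos'] with x hx
      exact mul_pos hc hx
  have hr : ∀ c, 0 < c → Tendsto (fun x => nuR p 1 (c * x) / nuR p 1 x) (𝓝[>] 0) (𝓝 c) := by
    intro c hc
    have h1 := h.comp (hmul c hc)
    have h2 := (hsv c⁻¹ (inv_pos.2 hc)).comp hinv
    have h3 := ((h1.mul h2).mul (h.inv₀ one_ne_zero)).mul_const c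
    simp only [mul_one, inv_one, one_mul] at h3
    refine h3.congr' ?_
    filter_upwards [hpos'] with x hx
    have e : c⁻¹ * (1 / x) = 1 / (c * x) := by field_simp
    simp only [Function.comp, e]
    have a1 := hℓ (1/x) (by positivity)
    have a2 := hℓ (1/(c*x)) (by positivity)
    have a3 := nuR_pos p hpos hs x hx
    field_simp
  set f : ℝ → ℝ := fun u => nuR p 1 (1/u) with hfdef
  have hf : AntitoneOn f (Set.Ioi 0) := by
    intro a ha b hb hab
    exact nuR_mono p hpos hs (one_div_le_one_div_of_le ha hab)
  have hfp : ∀ u, 0 < u → 0 < f u := fun u hu => nuR_pos p hpos hs _ (by positivity)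
  have hf2 : Tendsto (fun y => f (2 * y) / f y) atTop (𝓝 (1/2)) := by
    refine ((hr (1/2) (by norm_num)).comp hinv').congr (fun y => ?_)
    simp only [Function.comp, hfdef]
    rw [one_div_mul_one_div]
  have hI : Tendsto (fun y => ∫ u in (1:ℝ)..y, f u) atTop atTop := I_atTop p hpos hmono hs hsum
  have hG := G_over_I hf hfp hf2
  have hIsv := I_sv hf hfp hI hG
  have hh : ∀ y, 1 ≤ y → IntervalIntegrable (fun u : ℝ => ℓ₀ u / u) volume 1 y := by
    intro y hy
    rcases hy.lt_or_eq with h1 | h1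
    · rw [intervalIntegrable_iff_integrableOn_Ioc_of_le hy]
      exact hint y h1
    · rw [← h1]
  have hhf : Tendsto (fun y => (ℓ₀ y / y) / f y) atTop (𝓝 1) := by
    have := (h.comp hinv').inv₀ one_ne_zero
    rw [inv_one] at this
    refine this.congr (fun y => ?_)
    simp only [Function.comp, hfdef, one_div_one_div, inv_div]
    ring
  have hLI0 := L_over_I hf hfp hh hhf hI
  have hLI : Tendsto (fun y => ellInt ℓ₀ y / ∫ u in (1:ℝ)..y, f u) atTop (𝓝 1) := by
    refine hLI0.congr' ?_
    filter_upwards [eventually_ge_atTop 1] with y hy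
    rw [ellInt, intervalIntegral.integral_of_le hy]
  have hIp := hI.eventually_gt_atTop 0
  refine ⟨sv_congr hIsv hIp hLI, ?_, ?_, ?_⟩
  · have := (hhf.mul hG).mul (hLI.inv₀ one_ne_zero)
    simp only [mul_zero, zero_mul] at this
    refine this.congr' ?_
    filter_upwards [hIp, eventually_gt_atTop 0] with y h1 hy
    have := hfp y hy
    rw [inv_div]
    have := h1.ne'
    field_simp
  · have hn : Tendsto (fun y => nubar p (1/y) / ∫ u in (1:ℝ)..y, f u) atTop (𝓝 1) := by
      have lo := (hG.const_sub 1)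
      have up := (hI.inv_tendsto_atTop).const_add 1
      rw [sub_zero] at lo
      rw [add_zero] at up
      refine tendsto_of_tendsto_of_tendsto_of_le_of_le' lo up ?_ ?_
      all_goals
        filter_upwards [hIp, eventually_ge_atTop 1] with y h1 hy
        have hy0 : 0 < y := by linarith
        have id := I_ident p hpos hs hsum y hy
        obtain ⟨b1, b2⟩ := nubar_bounds p hpos hs (1/y) (by positivity)
        have e : nuR p 1 (1/y) / (1/y) = y * f y := by simp [hfdef, mul_comm]
        rw [e] at b2
        change ∫ u in (1:ℝ)..y, f u = _ - 1 + y * f y at id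
      · rw [le_div_iff₀ h1, sub_mul, one_mul, div_mul_cancel₀ _ h1.ne']
        linarith
      · rw [div_le_iff₀ h1, add_mul, one_mul, Pi.inv_apply, inv_mul_cancel₀ h1.ne']
        linarith
    have := (hn.mul (hLI.inv₀ one_ne_zero)).comp hinv
    rw [inv_one, mul_one] at this
    refine this.congr' ?_
    filter_upwards [hinv.eventually hIp] with x h1
    simp only [Function.comp, one_div_one_div, inv_div]
    have := h1.ne'
    field_simp
  · intro r hr1
    obtain ⟨m, rfl⟩ : ∃ m, r = m + 2 := ⟨r - 2, by omega⟩
    have := ((part_two p hpos hs hr m).mul h).mul_const ((m:ℝ)+2)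
    have e : 1 / ((m:ℝ)+2) * 1 * ((m:ℝ)+2) = 1 := by field_simp
    rw [e] at this
    refine this.congr' ?_
    filter_upwards [hpos'] with x hx
    have a3 := nuR_pos p hpos hs x hx
    have a1 := hℓ (1/x) (by positivity)
    push_cast
    field_simp
    ring

/-- Slow variation: if `ν_1[0,x] ∼ x ℓ_0(1/x)` with `ℓ_0` slowly varying, then
`ℓ(y) = ∫_1^y u^{-1} ℓ_0(u) du` is slowly varying with `ℓ_0 ≪ ℓ`, and
(i) `ν̄(x) ∼ ℓ(1/x)`, (ii) for `r > 1`, `ν_r[0,x] ∼ (1/r) x^r ℓ_0(1/x)`.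
Conversely, `ν̄(x) ∼ ℓ(1/x)` for some slowly varying `ℓ` implies
`ν_1[0,x] ≪ x ℓ(1/x)` as `x → 0+`. -/
theorem stmt_16 (p : ℕ → ℝ) (hpos : ∀ j, 0 < p j) (hmono : Antitone p)
    (hsum : ∑' j, p j = 1) :
    (∀ ℓ₀ : ℝ → ℝ, Measurable ℓ₀ → (∀ y : ℝ, 0 < y → 0 < ℓ₀ y) →
      SlowlyVarying ℓ₀ →
      (∀ y : ℝ, 1 < y → IntegrableOn (fun u : ℝ => ℓ₀ u / u) (Set.Ioc 1 y)) →
      Tendsto (fun x : ℝ => nuR p 1 x / (x * ℓ₀ (1 / x))) (𝓝[>] 0) (𝓝 1) →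
      SlowlyVarying (ellInt ℓ₀) ∧
      Tendsto (fun y : ℝ => ℓ₀ y / ellInt ℓ₀ y) atTop (𝓝 0) ∧
      Tendsto (fun x : ℝ => nubar p x / ellInt ℓ₀ (1 / x)) (𝓝[>] 0) (𝓝 1) ∧
      (∀ r : ℕ, 1 < r →
        Tendsto
          (fun x : ℝ => nuR p r x / (1 / (r : ℝ) * x ^ (r : ℕ) * ℓ₀ (1 / x)))
          (𝓝[>] 0) (𝓝 1))) ∧
    (∀ ℓ : ℝ → ℝ, (∀ y : ℝ, 0 < y → 0 < ℓ y) → SlowlyVarying ℓ →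
      Tendsto (fun x : ℝ => nubar p x / ℓ (1 / x)) (𝓝[>] 0) (𝓝 1) →
      Tendsto (fun x : ℝ => nuR p 1 x / (x * ℓ (1 / x))) (𝓝[>] 0) (𝓝 0)) := by
  have hs := aux_summable p hsum
  exact ⟨fun ℓ₀ _ h1 h2 h3 h4 => forward_part p hpos hmono hs hsum ℓ₀ h1 h2 h3 h4,
    fun ℓ h1 h2 h3 => converse_part p hpos hs hsum ℓ h1 h2 h3⟩
end
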